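/- Stability bound for the convection term (conclusion of the estimate of Λ₂ in Theorem 2.1): let m ≥ 1, θ ≥ 1/2, and let F : ℝ → ℝ^{m×m} be continuously differentiable, 2π-periodic, with F(x) symmetric positive semidefinite for every x and with spectral norm ‖F′(x)‖ ≤ M for all x. Then for every ℝ^m-valued piecewise polynomial ξ = (ξ_j)_{j=1}^N of degree ≤ k on the periodic partition, Σ_{j=1}^N ∫_{I_j} ξ_j′(x)^T F(x) ξ_j(x) dx + Σ_{j=1}^N [ξ]_{j+1/2}^T F(x_{j+1/2}) ξ^{(θ)}_{j+1/2} ≤ (M/2) Σ_{j=1}^N ∫_{I_j} ‖ξ_j(x)‖² dx, where ‖·‖ is the Euclidean norm on ℝ^m. -/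

import Mathlib

open Polynomial

/-- Weighted average `ξ^{(θ)}` (componentwise) of a vector-valued piecewise polynomial
at the node to the right of cell `j`, with periodic indexing. -/
noncomputable def avgV {N m : ℕ} [NeZero N] (x : Fin (N + 1) → ℝ) (θ : ℝ)
    (ξ : Fin N → Fin m → Polynomial ℝ) (j : Fin N) (i : Fin m) : ℝ :=
  θ * (ξ j i).eval (x j.succ) + (1 - θ) * (ξ (j + 1) i).eval (x (j + 1).castSucc)

/-- Jump `[ξ]` (componentwise) of a vector-valued piecewise polynomial at the node
to the right of cell `j`, with periodic indexing. -/
noncomputable def jumpV {N m : ℕ} [NeZero N] (x : Fin (N + 1) → ℝ)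
    (ξ : Fin N → Fin m → Polynomial ℝ) (j : Fin N) (i : Fin m) : ℝ :=
  (ξ (j + 1) i).eval (x (j + 1).castSucc) - (ξ j i).eval (x j.succ)

/-- bilinear form of a matrix -/
def bilV {m : ℕ} (A : Matrix (Fin m) (Fin m) ℝ) (v w : Fin m → ℝ) : ℝ :=
  ∑ i : Fin m, v i * ∑ l : Fin m, A i l * w l

lemma bilV_eq {m : ℕ} (A : Matrix (Fin m) (Fin m) ℝ) (v w : Fin m → ℝ) :
    bilV A v w = ∑ i : Fin m, ∑ l : Fin m, v i * A i l * w l := by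
  simp only [bilV, Finset.mul_sum, mul_assoc]

lemma bilV_symm {m : ℕ} (A : Matrix (Fin m) (Fin m) ℝ) (hA : A.PosSemidef) (v w : Fin m → ℝ) :
    bilV A v w = bilV A w v := by
  rw [bilV_eq, bilV_eq, Finset.sum_comm]
  refine Finset.sum_congr rfl fun i _ => Finset.sum_congr rfl fun l _ => ?_
  have h := hA.1.apply i l
  simp only [star_trivial] at h
  rw [h]; ring

lemma bilV_nonneg {m : ℕ} (A : Matrix (Fin m) (Fin m) ℝ) (hA : A.PosSemidef) (v : Fin m → ℝ) :
    0 ≤ bilV A v v := by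
  have h := hA.dotProduct_mulVec_nonneg v
  simpa [bilV, dotProduct, Matrix.mulVec] using h

lemma bilV_jump {m : ℕ} (A : Matrix (Fin m) (Fin m) ℝ) (hA : A.PosSemidef) (a b : Fin m → ℝ)
    (θ : ℝ) (hθ : 1 / 2 ≤ θ) :
    bilV A (fun i => b i - a i) (fun i => θ * a i + (1 - θ) * b i)
      ≤ 1 / 2 * (bilV A b b - bilV A a a) := by
  have h1 : bilV A (fun i => b i - a i) (fun i => θ * a i + (1 - θ) * b i)
      = θ * bilV A b a + (1 - θ) * bilV A b b - θ * bilV A a a - (1 - θ) * bilV A a b := by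
    simp only [bilV_eq, Finset.mul_sum, ← Finset.sum_add_distrib, ← Finset.sum_sub_distrib]
    refine Finset.sum_congr rfl fun i _ => Finset.sum_congr rfl fun l _ => ?_
    ring
  have h2 : bilV A (fun i => b i - a i) (fun i => b i - a i)
      = bilV A b b - bilV A b a - bilV A a b + bilV A a a := by
    simp only [bilV_eq, ← Finset.sum_add_distrib, ← Finset.sum_sub_distrib]
    refine Finset.sum_congr rfl fun i _ => Finset.sum_congr rfl fun l _ => ?_
    ring
  have h3 := bilV_nonneg A hA (fun i => b i - a i)
  have h4 := bilV_symm A hA a b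
  rw [h1]
  rw [h2] at h3
  rw [h4] at h3 ⊢
  nlinarith [mul_nonneg (sub_nonneg.2 hθ) h3]

lemma cell_bound {m : ℕ} (M : ℝ) (F F' : ℝ → Matrix (Fin m) (Fin m) ℝ)
    (hderiv : ∀ (i l : Fin m) (t : ℝ), HasDerivAt (fun s => F s i l) (F' t i l) t)
    (hcont : ∀ i l : Fin m, Continuous fun t => F' t i l)
    (hpsd : ∀ t : ℝ, (F t).PosSemidef)
    (hM : ∀ (t : ℝ) (v w : Fin m → ℝ),
      |∑ i : Fin m, v i * ∑ l : Fin m, F' t i l * w l|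
        ≤ M * Real.sqrt (∑ i : Fin m, v i ^ 2) * Real.sqrt (∑ l : Fin m, w l ^ 2))
    (p : Fin m → Polynomial ℝ) (a b : ℝ) (hab : a ≤ b) :
    ∫ t in a..b, bilV (F t) (fun i => (derivative (p i)).eval t) (fun i => (p i).eval t)
      ≤ 1 / 2 * (bilV (F b) (fun i => (p i).eval b) (fun i => (p i).eval b)
          - bilV (F a) (fun i => (p i).eval a) (fun i => (p i).eval a))
        + M / 2 * ∫ t in a..b, ∑ i : Fin m, ((p i).eval t) ^ 2 := by
  have hF : ∀ i l : Fin m, Continuous fun t => F t i l := fun i l =>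
    continuous_iff_continuousAt.2 fun t => (hderiv i l t).continuousAt
  have c1 : Continuous fun t =>
      bilV (F t) (fun i => (derivative (p i)).eval t) (fun i => (p i).eval t) := by
    unfold bilV; fun_prop
  have c2 : Continuous fun t =>
      bilV (F' t) (fun i => (p i).eval t) (fun i => (p i).eval t) := by
    unfold bilV; fun_prop
  have c3 : Continuous fun t => ∑ i : Fin m, ((p i).eval t) ^ 2 := by fun_prop
  have hd : ∀ t, HasDerivAt (fun t => bilV (F t) (fun i => (p i).eval t) (fun i => (p i).eval t))
      (2 * bilV (F t) (fun i => (derivative (p i)).eval t) (fun i => (p i).eval t)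
        + bilV (F' t) (fun i => (p i).eval t) (fun i => (p i).eval t)) t := by
    intro t
    have h : HasDerivAt
        (fun t => ∑ i : Fin m, ∑ l : Fin m, (p i).eval t * F t i l * (p l).eval t)
        (∑ i : Fin m, ∑ l : Fin m,
          (((derivative (p i)).eval t * F t i l + (p i).eval t * F' t i l) * (p l).eval t
            + (p i).eval t * F t i l * (derivative (p l)).eval t)) t := by
      refine HasDerivAt.fun_sum fun i _ => HasDerivAt.fun_sum fun l _ => ?_
      exact (((p i).hasDerivAt t).mul (hderiv i l t)).mul ((p l).hasDerivAt t)
    simp only [← bilV_eq] at h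
    convert h using 1
    rw [two_mul]
    nth_rewrite 2 [bilV_symm _ (hpsd t)]
    simp only [bilV_eq, ← Finset.sum_add_distrib]
    refine Finset.sum_congr rfl fun i _ => Finset.sum_congr rfl fun l _ => ?_
    ring
  have hI := intervalIntegral.integral_eq_sub_of_hasDerivAt (a := a) (b := b)
    (fun t _ => hd t) (((c1.const_mul 2).add c2).intervalIntegrable a b)
  rw [intervalIntegral.integral_add ((c1.const_mul 2).intervalIntegrable a b)
    (c2.intervalIntegrable a b), intervalIntegral.integral_const_mul] at hI
  have hL : ∫ t in a..b, -(M * ∑ i : Fin m, ((p i).eval t) ^ 2)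
      ≤ ∫ t in a..b, bilV (F' t) (fun i => (p i).eval t) (fun i => (p i).eval t) := by
    refine intervalIntegral.integral_mono_on hab
      ((continuous_const.mul c3).neg.intervalIntegrable a b) (c2.intervalIntegrable a b) ?_
    intro t _
    have h := hM t (fun i => (p i).eval t) (fun i => (p i).eval t)
    rw [mul_assoc, Real.mul_self_sqrt (Finset.sum_nonneg fun i _ => sq_nonneg _)] at h
    exact (abs_le.1 h).1
  rw [intervalIntegral.integral_neg, intervalIntegral.integral_const_mul] at hL
  linarith

lemma node_per {N m : ℕ} [NeZero N]
    (x : Fin (N + 1) → ℝ) (hx0 : x 0 = 0) (hxN : x (Fin.last N) = 2 * Real.pi)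
    (F : ℝ → Matrix (Fin m) (Fin m) ℝ) (hper : ∀ t : ℝ, F (t + 2 * Real.pi) = F t)
    (j : Fin N) : F (x j.succ) = F (x (j + 1).castSucc) := by
  obtain ⟨n, rfl⟩ : ∃ n, N = n + 1 := ⟨N - 1, by have := NeZero.ne N; omega⟩
  by_cases hj : j = Fin.last n
  · subst hj
    have e : Fin.last n + 1 = 0 := Fin.last_add_one n
    rw [e, Fin.succ_last, hxN, Fin.castSucc_zero, hx0, ← hper 0, zero_add]
  · congr 2
    apply Fin.ext
    simp [Fin.val_add_one, hj]

/-- stability bound for the convection term (conclusion of the estimate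
of Λ₂): with `θ ≥ 1/2`, `F` a `C¹`, `2π`-periodic, pointwise symmetric positive
semidefinite matrix-valued function whose derivative has spectral norm `≤ M`
(encoded by the bilinear-form bound `|vᵀ F′(t) w| ≤ M ‖v‖ ‖w‖` in Euclidean norms),
for every `ℝ^m`-valued piecewise polynomial `ξ` of degree `≤ k`,
`Σ_j ∫_{I_j} ξ′ᵀ F ξ dx + Σ_j [ξ]ᵀ F(x_{j+1/2}) ξ^{(θ)} ≤ (M/2) Σ_j ∫_{I_j} ‖ξ‖² dx`. -/
theorem statement3 {N m k : ℕ} [NeZero N] (hm : 1 ≤ m) (hk : 1 ≤ k)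
    (x : Fin (N + 1) → ℝ) (hx0 : x 0 = 0) (hxN : x (Fin.last N) = 2 * Real.pi)
    (hmono : StrictMono x) (θ : ℝ) (hθ : 1 / 2 ≤ θ) (M : ℝ)
    (F F' : ℝ → Matrix (Fin m) (Fin m) ℝ)
    (hderiv : ∀ (i l : Fin m) (t : ℝ), HasDerivAt (fun s => F s i l) (F' t i l) t)
    (hcont : ∀ i l : Fin m, Continuous fun t => F' t i l)
    (hpsd : ∀ t : ℝ, (F t).PosSemidef)
    (hper : ∀ t : ℝ, F (t + 2 * Real.pi) = F t)
    (hM : ∀ (t : ℝ) (v w : Fin m → ℝ),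
      |∑ i : Fin m, v i * ∑ l : Fin m, F' t i l * w l|
        ≤ M * Real.sqrt (∑ i : Fin m, v i ^ 2) * Real.sqrt (∑ l : Fin m, w l ^ 2))
    (ξ : Fin N → Fin m → Polynomial ℝ) (hξ : ∀ j i, (ξ j i).natDegree ≤ k) :
    (∑ j : Fin N, ∫ t in (x j.castSucc)..(x j.succ),
        ∑ i : Fin m, (Polynomial.derivative (ξ j i)).eval t
          * ∑ l : Fin m, F t i l * (ξ j l).eval t)
      + ∑ j : Fin N, ∑ i : Fin m, jumpV x ξ j i
          * ∑ l : Fin m, F (x j.succ) i l * avgV x θ ξ j l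
    ≤ (M / 2) * ∑ j : Fin N, ∫ t in (x j.castSucc)..(x j.succ),
        ∑ i : Fin m, ((ξ j i).eval t) ^ 2 := by
  have hc : ∀ j : Fin N, _ := fun j => cell_bound M F F' hderiv hcont hpsd hM (ξ j)
    (x j.castSucc) (x j.succ) (hmono.monotone (Fin.castSucc_lt_succ).le)
  have hs := Finset.sum_le_sum fun j (_ : j ∈ Finset.univ) => hc j
  have hj : ∀ j : Fin N, _ := fun j => bilV_jump (F (x j.succ)) (hpsd _)
    (fun i => (ξ j i).eval (x j.succ)) (fun i => (ξ (j + 1) i).eval (x (j + 1).castSucc)) θ hθ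
  have hs2 := Finset.sum_le_sum fun j (_ : j ∈ Finset.univ) => hj j
  have hre : ∑ j : Fin N, bilV (F (x j.succ)) (fun i => (ξ (j + 1) i).eval (x (j + 1).castSucc))
        (fun i => (ξ (j + 1) i).eval (x (j + 1).castSucc))
      = ∑ j : Fin N, bilV (F (x j.castSucc)) (fun i => (ξ j i).eval (x j.castSucc))
        (fun i => (ξ j i).eval (x j.castSucc)) := by
    simp only [node_per x hx0 hxN F hper]
    exact Equiv.sum_comp (Equiv.addRight (1 : Fin N)) (fun j => bilV (F (x j.castSucc))
      (fun i => (ξ j i).eval (x j.castSucc)) (fun i => (ξ j i).eval (x j.castSucc)))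
  simp only [Finset.sum_add_distrib, ← Finset.mul_sum, Finset.sum_sub_distrib] at hs hs2
  rw [hre] at hs2
  have := add_le_add hs hs2
  simp only [bilV] at this
  simp only [jumpV, avgV]
  linarith
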